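/- arXiv:1210.1744 — 6 statements merged into one kernel-verified Lean document; each statement's English description precedes it below -/
import Mathlib

section
/- Let ν ≥ 1, let k, a ∈ ℂ, let g : ℝ → Mat_ν(ℂ) be continuously differentiable, 2π-periodic, with g(x) invertible for every x ∈ ℝ, and let l, A : ℝ → Mat_ν(ℂ) be continuous and 2π-periodic. Then ⟨g l g⁻¹ − k g′ g⁻¹, g A g⁻¹⟩ + k·(a + ⟨g⁻¹ g′, A⟩) = ⟨l, A⟩ + k·a, where g′ is the pointwise derivative of g and all products are pointwise matrix products. (This is the invariance g*α⁽¹⁾ = α⁽¹⁾ of the Liouville 1-form α⁽¹⁾(T,c;l,k) = (l,dT)₋₁ + k dc under the loop-group action g:(T,c;l,k) ↦ (gTg⁻¹, c+(g⁻¹g_x,T)₋₁; glg⁻¹ − k g_x g⁻¹, k), the computational content of Lemma 1.1.) -/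
open scoped Real

attribute [local instance] Matrix.normedAddCommGroup Matrix.normedSpace

/-- Conjugation invariance of the trace pairing, with an extra term `k • (N * M⁻¹)`. -/
theorem Matrix.trace_conj_sub_smul_mul_conj {n R : Type*} [Fintype n] [DecidableEq n]
    [CommRing R] {M : Matrix n n R} (hM : IsUnit M) (k : R) (N L B : Matrix n n R) :
    ((M * L * M⁻¹ - k • (N * M⁻¹)) * (M * B * M⁻¹)).trace
      = (L * B).trace - k * (M⁻¹ * N * B).trace := by
  have h : M⁻¹ * M = 1 := Matrix.nonsing_inv_mul M ((Matrix.isUnit_iff_isUnit_det M).mp hM)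
  have hL : M * L * M⁻¹ * (M * B * M⁻¹) = M * (L * B) * M⁻¹ := by
    simp only [Matrix.mul_assoc, ← Matrix.mul_assoc M⁻¹ M, h, Matrix.one_mul]
  have hN : N * M⁻¹ * (M * B * M⁻¹) = N * B * M⁻¹ := by
    simp only [Matrix.mul_assoc, ← Matrix.mul_assoc M⁻¹ M, h, Matrix.one_mul]
  rw [Matrix.sub_mul, Matrix.smul_mul, Matrix.trace_sub, Matrix.trace_smul, smul_eq_mul, hL, hN,
    Matrix.trace_mul_comm _ M⁻¹, Matrix.trace_mul_comm _ M⁻¹, ← Matrix.mul_assoc M⁻¹ M, h,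
    Matrix.one_mul, Matrix.mul_assoc M⁻¹ N B]

/-- The pointwise inverse of a continuous family of invertible matrices is continuous. -/
theorem Continuous.matrix_nonsing_inv {X n 𝕜 : Type*} [TopologicalSpace X] [Fintype n]
    [DecidableEq n] [NormedField 𝕜] {f : X → Matrix n n 𝕜} (hf : Continuous f)
    (hu : ∀ x, IsUnit (f x)) : Continuous fun x => (f x)⁻¹ := by
  simp only [Matrix.inv_def, Ring.inverse_eq_inv']
  exact (hf.matrix_det.inv₀ fun x => ((Matrix.isUnit_iff_isUnit_det _).mp (hu x)).ne_zero).smul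
    hf.matrix_adjugate

/-- invariance of the Liouville 1-form under the loop-group action
(Lemma 1.1, computation (1.8)). -/
theorem liouville_form_invariance
    (ν : ℕ) (hν : 1 ≤ ν) (k a : ℂ)
    (g g' l A : ℝ → Matrix (Fin ν) (Fin ν) ℂ)
    (hg : ∀ x, HasDerivAt g (g' x) x) (hg' : Continuous g')
    (hgper : Function.Periodic g (2 * π))
    (hginv : ∀ x, IsUnit (g x))
    (hl : Continuous l) (hlper : Function.Periodic l (2 * π))
    (hA : Continuous A) (hAper : Function.Periodic A (2 * π)) :
    (∫ x in (0:ℝ)..(2 * π),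
        ((g x * l x * (g x)⁻¹ - k • (g' x * (g x)⁻¹)) * (g x * A x * (g x)⁻¹)).trace)
      + k * (a + ∫ x in (0:ℝ)..(2 * π), ((g x)⁻¹ * g' x * A x).trace)
    = (∫ x in (0:ℝ)..(2 * π), (l x * A x).trace) + k * a := by
  have hgc : Continuous g := continuous_iff_continuousAt.mpr fun x => (hg x).continuousAt
  have hgi : Continuous fun x => (g x)⁻¹ := hgc.matrix_nonsing_inv hginv
  have h₁ : Continuous fun x => (l x * A x).trace := (hl.matrix_mul hA).matrix_trace
  have h₂ : Continuous fun x => k * ((g x)⁻¹ * g' x * A x).trace :=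
    continuous_const.mul ((hgi.matrix_mul hg').matrix_mul hA).matrix_trace
  simp only [fun x => Matrix.trace_conj_sub_smul_mul_conj (hginv x)]
  rw [intervalIntegral.integral_sub (h₁.intervalIntegrable _ _) (h₂.intervalIntegrable _ _),
    intervalIntegral.integral_const_mul]
  ring
end

section
/- Let ν ≥ 1, let l : ℝ → Mat_ν(ℂ) be continuous and 2π-periodic, and let F : ℝ → Mat_ν(ℂ) be differentiable with F′(x) = l(x)F(x) and F(x) invertible for every x ∈ ℝ. Then the function x ↦ tr( F(x+2π)·F(x)⁻¹ ) is constant on ℝ. -/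
open scoped Real

attribute [local instance] Matrix.normedAddCommGroup Matrix.normedSpace

/-- If `F` and `G` solve the same linear differential equation in a Banach algebra and `F` is
invertible, then `F⁻¹ G` is constant. -/
theorem ringInverse_mul_eq_of_hasDerivAt_mul {A : Type*} [NormedRing A] [NormedAlgebra ℝ A]
    [CompleteSpace A] {l F G : ℝ → A}
    (hF : ∀ x, HasDerivAt F (l x * F x) x) (hG : ∀ x, HasDerivAt G (l x * G x) x)
    (hFu : ∀ x, IsUnit (F x)) (x y : ℝ) :
    Ring.inverse (F x) * G x = Ring.inverse (F y) * G y := by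
  have h_deriv : ∀ t, HasDerivAt (fun t => Ring.inverse (F t) * G t) 0 t := by
    intro t
    obtain ⟨u, hu⟩ := hFu t
    have hinv := hasFDerivAt_ringInverse (𝕜 := ℝ) u
    rw [hu] at hinv
    refine ((hinv.comp_hasDerivAt t (hF t)).mul (hG t)).congr_deriv ?_
    simp [← hu, mul_assoc]
  exact is_const_of_deriv_eq_zero (fun t => (h_deriv t).differentiableAt)
    (fun t => (h_deriv t).deriv) x y

/-- The Banach algebra fact for matrices, where `HasDerivAt` refers to the entrywise norm. -/
theorem matrix_inv_mul_eq_of_hasDerivAt_mul {n : Type*} [Fintype n] [DecidableEq n]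
    {l F G : ℝ → Matrix n n ℂ}
    (hF : ∀ x, HasDerivAt F (l x * F x) x) (hG : ∀ x, HasDerivAt G (l x * G x) x)
    (hFu : ∀ x, IsUnit (F x)) (x y : ℝ) :
    (F x)⁻¹ * G x = (F y)⁻¹ * G y := by
  let : NormedRing (Matrix n n ℂ) := Matrix.linftyOpNormedRing
  let : NormedAlgebra ℝ (Matrix n n ℂ) := Matrix.linftyOpNormedAlgebra
  rw [Matrix.nonsing_inv_eq_ringInverse, Matrix.nonsing_inv_eq_ringInverse]
  exact @ringInverse_mul_eq_of_hasDerivAt_mul _ _ _ (FiniteDimensional.complete ℝ _) _ _ _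
    hF hG hFu x y

/-- base-point independence of the generating functional of conservation
laws (formula (S3.13)): the trace of the monodromy matrix F(x+2π)F(x)⁻¹ of the
periodic spectral problem F′ = lF is constant in x. -/
theorem monodromy_trace_constant
    (ν : ℕ) (hν : 1 ≤ ν)
    (l F : ℝ → Matrix (Fin ν) (Fin ν) ℂ)
    (hl : Continuous l) (hlper : Function.Periodic l (2 * π))
    (hF : ∀ x, HasDerivAt F (l x * F x) x)
    (hFinv : ∀ x, IsUnit (F x)) :
    ∀ x y : ℝ,
      (F (x + 2 * π) * (F x)⁻¹).trace = (F (y + 2 * π) * (F y)⁻¹).trace := by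
  intro x y
  have hG : ∀ t, HasDerivAt (fun t => F (t + 2 * π)) (l t * F (t + 2 * π)) t := fun t =>
    ((hF (t + 2 * π)).comp_add_const t (2 * π)).congr_deriv (by rw [hlper t])
  rw [Matrix.trace_mul_comm, Matrix.trace_mul_comm (F (y + 2 * π)),
    matrix_inv_mul_eq_of_hasDerivAt_mul hF hG hFinv x y]
end

section
/- Let ν ≥ 1 and let R : Mat_ν(ℂ) → Mat_ν(ℂ) be a ℂ-linear map that is antisymmetric with respect to the trace form, i.e. tr(R(A)·B) = −tr(A·R(B)) for all A, B ∈ Mat_ν(ℂ). For T ∈ Mat_ν(ℂ) define D : Mat_ν(ℂ) → Mat_ν(ℂ) by D(Z) := (1/2)·R(T·Z + Z·T). Then for all X, Y ∈ Mat_ν(ℂ): tr( T·([D(X), Y] + [X, D(Y)]) ) = tr( T·X·R(T·Y) ) − tr( X·T·R(Y·T) ). -/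
/-- the computation (3.4) of Section 5: for an antisymmetric R-structure,
the D-structure D(Z) = ½R(TZ + ZT) of formula (3.2) satisfies
tr(T·[X,Y]_D) = tr(TX·R(TY)) − tr(XT·R(YT)), i.e. the D-bracket (2.21) coincides with
the R-matrix form (3.3) of the reduced Poisson bracket. -/
theorem D_structure_R_structure_compatibility
    (ν : ℕ) (hν : 1 ≤ ν)
    (R : Matrix (Fin ν) (Fin ν) ℂ →ₗ[ℂ] Matrix (Fin ν) (Fin ν) ℂ)
    (hR : ∀ A B : Matrix (Fin ν) (Fin ν) ℂ, (R A * B).trace = -(A * R B).trace)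
    (T : Matrix (Fin ν) (Fin ν) ℂ)
    (D : Matrix (Fin ν) (Fin ν) ℂ → Matrix (Fin ν) (Fin ν) ℂ)
    (hD : ∀ Z, D Z = (1 / 2 : ℂ) • R (T * Z + Z * T)) :
    ∀ X Y : Matrix (Fin ν) (Fin ν) ℂ,
      (T * ((D X * Y - Y * D X) + (X * D Y - D Y * X))).trace
        = (T * X * R (T * Y)).trace - (X * T * R (Y * T)).trace := by
  intro X Y
  have hX : (T * (D X * Y - Y * D X)).trace = (D X * (Y * T - T * Y)).trace := by
    simp only [mul_sub, Matrix.trace_sub]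
    rw [Matrix.trace_mul_comm T, ← mul_assoc T, Matrix.trace_mul_comm (T * Y), mul_assoc]
  have hY : (T * (X * D Y - D Y * X)).trace = ((T * X - X * T) * D Y).trace := by
    simp only [mul_sub, sub_mul, Matrix.trace_sub]
    rw [← mul_assoc, ← mul_assoc, Matrix.trace_mul_comm (T * D Y), ← mul_assoc]
  have hRX := hR (T * X + X * T) (Y * T - T * Y)
  rw [mul_add, Matrix.trace_add, hX, hY, hD X, hD Y, smul_mul_assoc, mul_smul_comm,
    Matrix.trace_smul, Matrix.trace_smul, hRX]
  simp only [map_add, map_sub, mul_add, mul_sub, add_mul, sub_mul, Matrix.trace_add,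
    Matrix.trace_sub, smul_eq_mul]
  ring
end

section
/- Let α, β ∈ ℝ and let ψ₁, ψ₂, ε : ℝ × ℝ → ℂ be continuously differentiable functions of (t, x), 2π-periodic in x, satisfying the three-wave system ∂ₜψ₁ = ∂ₓψ₁ + iα·conj(ε)·ψ₂, ∂ₜψ₂ = −∂ₓψ₂ + iα·ε·ψ₁, ∂ₜε = −β·∂ₓε + iα·conj(ψ₁)·ψ₂. Then the fermionic number functional N_F(t) := ∫₀^{2π} ( |ψ₁(t,x)|² + |ψ₂(t,x)|² ) dx is constant in t. -/
open scoped Real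

/-- The partial derivative in the first variable is the total derivative applied to `(1, 0)`. -/
lemma hasDerivAt_fst_slice {E : Type*} [NormedAddCommGroup E] [NormedSpace ℝ E] {f : ℝ × ℝ → E}
    (hf : Differentiable ℝ f) (t x : ℝ) :
    HasDerivAt (fun s => f (s, x)) (fderiv ℝ f (t, x) (1, 0)) t :=
  (hf (t, x)).hasFDerivAt.comp_hasDerivAt t
    ((hasDerivAt_id t).prodMk (hasDerivAt_const t x))

/-- The partial derivative in the second variable is the total derivative applied to `(0, 1)`. -/
lemma hasDerivAt_snd_slice {E : Type*} [NormedAddCommGroup E] [NormedSpace ℝ E] {f : ℝ × ℝ → E}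
    (hf : Differentiable ℝ f) (t x : ℝ) :
    HasDerivAt (fun y => f (t, y)) (fderiv ℝ f (t, x) (0, 1)) x :=
  (hf (t, x)).hasFDerivAt.comp_hasDerivAt x
    ((hasDerivAt_const x t).prodMk (hasDerivAt_id x))

/-- A density satisfying a continuity equation with a spatially periodic flux has a conserved
integral over a period. -/
lemma integral_eq_of_continuity_equation {ρ j : ℝ × ℝ → ℝ} {T : ℝ}
    (hρ : ContDiff ℝ 1 ρ) (hj : ContDiff ℝ 1 j)
    (hper : ∀ t, Function.Periodic (fun x => j (t, x)) T)
    (hcons : ∀ p, fderiv ℝ ρ p (1, 0) + fderiv ℝ j p (0, 1) = 0) (t₁ t₂ : ℝ) :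
    ∫ x in (0 : ℝ)..T, ρ (t₁, x) = ∫ x in (0 : ℝ)..T, ρ (t₂, x) := by
  have hdiv := MeasureTheory.integral2_divergence_prod_of_hasFDerivAt ρ j
    (fderiv ℝ ρ) (fderiv ℝ j) t₁ 0 t₂ T hρ.continuous.continuousOn hj.continuous.continuousOn
    (fun p _ => (hρ.differentiable one_ne_zero p).hasFDerivAt)
    (fun p _ => (hj.differentiable one_ne_zero p).hasFDerivAt)
    (by simp [hcons])
  have hflux : ∀ t, j (t, T) = j (t, 0) := fun t => by simpa using hper t 0
  simp only [hcons, hflux, intervalIntegral.integral_zero, sub_self, zero_add] at hdiv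
  linarith

/-- conservation of the fermionic particle number
N_F = ∫(|ψ₁|² + |ψ₂|²)dx (formula (S1.9a)) for the classical three-wave
superradiance system (S1.9)/(S2). -/
theorem fermion_number_conserved
    (α β : ℝ) (ψ₁ ψ₂ ε : ℝ × ℝ → ℂ)
    (hψ₁ : ContDiff ℝ 1 ψ₁) (hψ₂ : ContDiff ℝ 1 ψ₂) (hε : ContDiff ℝ 1 ε)
    (hψ₁per : ∀ t : ℝ, Function.Periodic (fun x => ψ₁ (t, x)) (2 * π))
    (hψ₂per : ∀ t : ℝ, Function.Periodic (fun x => ψ₂ (t, x)) (2 * π))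
    (hεper : ∀ t : ℝ, Function.Periodic (fun x => ε (t, x)) (2 * π))
    (heq1 : ∀ t x : ℝ, deriv (fun s => ψ₁ (s, x)) t
      = deriv (fun y => ψ₁ (t, y)) x
        + Complex.I * (α : ℂ) * (starRingEnd ℂ) (ε (t, x)) * ψ₂ (t, x))
    (heq2 : ∀ t x : ℝ, deriv (fun s => ψ₂ (s, x)) t
      = -deriv (fun y => ψ₂ (t, y)) x
        + Complex.I * (α : ℂ) * ε (t, x) * ψ₁ (t, x))
    (heq3 : ∀ t x : ℝ, deriv (fun s => ε (s, x)) t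
      = -(β : ℂ) * deriv (fun y => ε (t, y)) x
        + Complex.I * (α : ℂ) * (starRingEnd ℂ) (ψ₁ (t, x)) * ψ₂ (t, x)) :
    ∀ t₁ t₂ : ℝ,
      (∫ x in (0:ℝ)..(2 * π), (‖ψ₁ (t₁, x)‖ ^ 2 + ‖ψ₂ (t₁, x)‖ ^ 2))
        = ∫ x in (0:ℝ)..(2 * π), (‖ψ₁ (t₂, x)‖ ^ 2 + ‖ψ₂ (t₂, x)‖ ^ 2) := by
  have hd₁ := hψ₁.differentiable one_ne_zero
  have hd₂ := hψ₂.differentiable one_ne_zero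
  have hn₁ : ContDiff ℝ 1 (fun p => ‖ψ₁ p‖ ^ 2) := hψ₁.norm_sq ℝ
  have hn₂ : ContDiff ℝ 1 (fun p => ‖ψ₂ p‖ ^ 2) := hψ₂.norm_sq ℝ
  refine integral_eq_of_continuity_equation (ρ := fun p => ‖ψ₁ p‖ ^ 2 + ‖ψ₂ p‖ ^ 2)
    (j := fun p => ‖ψ₂ p‖ ^ 2 - ‖ψ₁ p‖ ^ 2) (hn₁.add hn₂) (hn₂.sub hn₁) ?_ ?_
  · intro t x
    have h₁ := hψ₁per t x
    have h₂ := hψ₂per t x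
    simp only at h₁ h₂ ⊢
    rw [h₁, h₂]
  · rintro ⟨t, x⟩
    have e₁ := heq1 t x
    have e₂ := heq2 t x
    rw [(hasDerivAt_fst_slice hd₁ t x).deriv, (hasDerivAt_snd_slice hd₁ t x).deriv] at e₁
    rw [(hasDerivAt_fst_slice hd₂ t x).deriv, (hasDerivAt_snd_slice hd₂ t x).deriv] at e₂
    have hρ := (hasDerivAt_fst_slice ((hn₁.add hn₂).differentiable one_ne_zero) t x).unique
      ((hasDerivAt_fst_slice hd₁ t x).norm_sq.add (hasDerivAt_fst_slice hd₂ t x).norm_sq)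
    have hj := (hasDerivAt_snd_slice ((hn₂.sub hn₁).differentiable one_ne_zero) t x).unique
      ((hasDerivAt_snd_slice hd₂ t x).norm_sq.sub (hasDerivAt_snd_slice hd₁ t x).norm_sq)
    rw [hρ, hj, e₁, e₂]
    simp only [Complex.inner, Complex.mul_re, Complex.mul_im, Complex.add_re, Complex.add_im,
      Complex.neg_re, Complex.neg_im, Complex.conj_re, Complex.conj_im, Complex.I_re,
      Complex.I_im, Complex.ofReal_re, Complex.ofReal_im]
    ring
end

section
/- Let α, β ∈ ℝ and let ψ₁, ψ₂, ε : ℝ × ℝ → ℂ be continuously differentiable functions of (t, x), 2π-periodic in x, satisfying the three-wave system ∂ₜψ₁ = ∂ₓψ₁ + iα·conj(ε)·ψ₂, ∂ₜψ₂ = −∂ₓψ₂ + iα·ε·ψ₁, ∂ₜε = −β·∂ₓε + iα·conj(ψ₁)·ψ₂. Then the bosonic number functional N_B(t) := ∫₀^{2π} ( |ε(t,x)|² + |ψ₂(t,x)|² ) dx is constant in t. -/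
open scoped Real

theorem integral_eq_of_conservation_law {f g : ℝ × ℝ → ℝ} (hf : ContDiff ℝ 1 f)
    (hg : ContDiff ℝ 1 g) {a b : ℝ} (hper : ∀ t, g (t, a) = g (t, b))
    (hdiv : ∀ p, fderiv ℝ f p (1, 0) + fderiv ℝ g p (0, 1) = 0) (t₁ t₂ : ℝ) :
    ∫ x in a..b, f (t₁, x) = ∫ x in a..b, f (t₂, x) := by
  have h := MeasureTheory.integral2_divergence_prod_of_hasFDerivAt f g (fderiv ℝ f) (fderiv ℝ g)
    t₁ a t₂ b hf.continuous.continuousOn hg.continuous.continuousOn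
    (fun p _ => (hf.differentiable one_ne_zero p).hasFDerivAt)
    (fun p _ => (hg.differentiable one_ne_zero p).hasFDerivAt)
    (by simp only [hdiv]; exact MeasureTheory.integrableOn_zero)
  simp only [hdiv, hper, intervalIntegral.integral_zero] at h
  linarith

theorem fderiv_apply_one_zero {E : Type*} [NormedAddCommGroup E] [NormedSpace ℝ E]
    {u : ℝ × ℝ → E} {t x : ℝ} (hu : DifferentiableAt ℝ u (t, x)) :
    fderiv ℝ u (t, x) (1, 0) = deriv (fun s => u (s, x)) t :=
  (hu.hasFDerivAt.comp_hasDerivAt t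
    ((hasDerivAt_id t).prodMk (hasDerivAt_const t x))).deriv.symm

theorem fderiv_apply_zero_one {E : Type*} [NormedAddCommGroup E] [NormedSpace ℝ E]
    {u : ℝ × ℝ → E} {t x : ℝ} (hu : DifferentiableAt ℝ u (t, x)) :
    fderiv ℝ u (t, x) (0, 1) = deriv (fun y => u (t, y)) x :=
  (hu.hasFDerivAt.comp_hasDerivAt x
    ((hasDerivAt_const x t).prodMk (hasDerivAt_id x))).deriv.symm

/-- conservation of the bosonic quanta number
N_B = ∫(|ε|² + |ψ₂|²)dx (formula (S1.9a)) for the classical three-wave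
superradiance system (S1.9)/(S2). -/
theorem boson_number_conserved
    (α β : ℝ) (ψ₁ ψ₂ ε : ℝ × ℝ → ℂ)
    (hψ₁ : ContDiff ℝ 1 ψ₁) (hψ₂ : ContDiff ℝ 1 ψ₂) (hε : ContDiff ℝ 1 ε)
    (hψ₁per : ∀ t : ℝ, Function.Periodic (fun x => ψ₁ (t, x)) (2 * π))
    (hψ₂per : ∀ t : ℝ, Function.Periodic (fun x => ψ₂ (t, x)) (2 * π))
    (hεper : ∀ t : ℝ, Function.Periodic (fun x => ε (t, x)) (2 * π))
    (heq1 : ∀ t x : ℝ, deriv (fun s => ψ₁ (s, x)) t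
      = deriv (fun y => ψ₁ (t, y)) x
        + Complex.I * (α : ℂ) * (starRingEnd ℂ) (ε (t, x)) * ψ₂ (t, x))
    (heq2 : ∀ t x : ℝ, deriv (fun s => ψ₂ (s, x)) t
      = -deriv (fun y => ψ₂ (t, y)) x
        + Complex.I * (α : ℂ) * ε (t, x) * ψ₁ (t, x))
    (heq3 : ∀ t x : ℝ, deriv (fun s => ε (s, x)) t
      = -(β : ℂ) * deriv (fun y => ε (t, y)) x
        + Complex.I * (α : ℂ) * (starRingEnd ℂ) (ψ₁ (t, x)) * ψ₂ (t, x)) :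
    ∀ t₁ t₂ : ℝ,
      (∫ x in (0:ℝ)..(2 * π), (‖ε (t₁, x)‖ ^ 2 + ‖ψ₂ (t₁, x)‖ ^ 2))
        = ∫ x in (0:ℝ)..(2 * π), (‖ε (t₂, x)‖ ^ 2 + ‖ψ₂ (t₂, x)‖ ^ 2) := by
  have hg : ContDiff ℝ 1 (fun p => β * ‖ε p‖ ^ 2 + ‖ψ₂ p‖ ^ 2) :=
    (contDiff_const.mul (hε.norm_sq ℝ)).add (hψ₂.norm_sq ℝ)
  refine integral_eq_of_conservation_law ((hε.norm_sq ℝ).add (hψ₂.norm_sq ℝ)) hg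
    (fun t => ?_) ?_
  · have h₁ := hεper t 0
    have h₂ := hψ₂per t 0
    simp only [zero_add] at h₁ h₂
    simp only [h₁, h₂]
  · rintro ⟨t, x⟩
    have dε := hε.differentiable one_ne_zero (t, x)
    have dψ := hψ₂.differentiable one_ne_zero (t, x)
    have nε := dε.hasFDerivAt.norm_sq
    have nψ := dψ.hasFDerivAt.norm_sq
    have e₂ := heq2 t x
    have e₃ := heq3 t x
    rw [← fderiv_apply_one_zero dψ, ← fderiv_apply_zero_one dψ] at e₂
    rw [← fderiv_apply_one_zero dε, ← fderiv_apply_zero_one dε] at e₃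
    rw [(nε.fun_add nψ).fderiv, ((nε.const_mul β).fun_add nψ).fderiv]
    simp only [add_apply, smul_apply,
      ContinuousLinearMap.comp_apply, innerSL_apply_apply, e₂, e₃, Complex.inner]
    simp
    ring
end

section
/- Let A be a (possibly noncommutative) ring, n ≥ 1, and let T₁, T₂ ∈ Mat_n(A). Let R, S ∈ Mat_{n²}(A) be matrices indexed by pairs (i,k) ∈ {1,…,n}×{1,…,n}, all of whose entries lie in the center of A, with R·S = 1 = S·R. Define M, N ∈ Mat_{n²}(A) by M_{(i,k),(j,l)} := (T₁)_{ij}·(T₂)_{kl} and N_{(i,k),(j,l)} := (T₂)_{kl}·(T₁)_{ij}. If R·M = N·R, then tr(T₁)·tr(T₂) = tr(T₂)·tr(T₁), i.e. the traces commute: [tr T₁, tr T₂] = 0. -/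
/-- The trace is cyclic for a product in which one factor has central entries. -/
theorem Matrix.trace_mul_comm_of_mem_center {A m n : Type*} [Ring A] [Fintype m] [Fintype n]
    (S : Matrix m n A) (X : Matrix n m A) (hS : ∀ i j, S i j ∈ Subring.center A) :
    (S * X).trace = (X * S).trace := by
  simp only [Matrix.trace, Matrix.diag_apply, Matrix.mul_apply]
  rw [Finset.sum_comm]
  exact Finset.sum_congr rfl fun j _ => Finset.sum_congr rfl fun i _ =>
    (Subring.mem_center_iff.mp (hS i j) (X j i)).symm

/-- the derivation (S3.12) ⇒ (S3.11): from the quantum R-matrix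
relation R·(T₁ ⊗ T₂) = (T₂ ⊗ T₁)·R with an invertible R-matrix having central
entries, the traces of the two monodromy matrices commute: [tr T₁, tr T₂] = 0. -/
theorem quantum_R_matrix_traces_commute
    (A : Type*) [Ring A] (n : ℕ) (hn : 1 ≤ n)
    (T₁ T₂ : Matrix (Fin n) (Fin n) A)
    (R S : Matrix (Fin n × Fin n) (Fin n × Fin n) A)
    (hRcentral : ∀ p q : Fin n × Fin n, R p q ∈ Subring.center A)
    (hScentral : ∀ p q : Fin n × Fin n, S p q ∈ Subring.center A)
    (hRS : R * S = 1) (hSR : S * R = 1)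
    (M N : Matrix (Fin n × Fin n) (Fin n × Fin n) A)
    (hM : ∀ i j k l : Fin n, M (i, k) (j, l) = T₁ i j * T₂ k l)
    (hN : ∀ i j k l : Fin n, N (i, k) (j, l) = T₂ k l * T₁ i j)
    (hRM : R * M = N * R) :
    T₁.trace * T₂.trace = T₂.trace * T₁.trace := by
  have hMN : M.trace = N.trace := by
    calc M.trace = (S * (N * R)).trace := by
          rw [← hRM, ← Matrix.mul_assoc, hSR, Matrix.one_mul]
      _ = (N * R * S).trace := Matrix.trace_mul_comm_of_mem_center S (N * R) hScentral
      _ = N.trace := by rw [Matrix.mul_assoc, hRS, Matrix.mul_one]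
  have hMtr : M.trace = T₁.trace * T₂.trace := by
    simp only [Matrix.trace, Matrix.diag_apply, Fintype.sum_prod_type, hM, Finset.sum_mul_sum]
  have hNtr : N.trace = T₂.trace * T₁.trace := by
    simp only [Matrix.trace, Matrix.diag_apply, Fintype.sum_prod_type_right, hN,
      Finset.sum_mul_sum]
  rw [← hMtr, hMN, hNtr]
end
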